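/- For ω > 1 and 0 < z < 1, the double sine function satisfies the descent relation S(ω,z) = 2 sin(πz/ω) · S(ω-1, z) / S(1 - 1/ω, z/ω). -/

import Mathlib

/-- `H` is the meromorphic continuation of Barnes' double zeta function
`ζ₂(s,ω,z) = ∑_{p,q≥0} (z + pω + q)^{-s}`. -/
def IsBarnesZeta2 (ω z : ℝ) (H : ℂ → ℂ) : Prop :=
  DifferentiableOn ℂ H ({1, 2} : Set ℂ)ᶜ ∧
    ∀ s : ℂ, 2 < s.re → H s = ∑' (p : ℕ) (q : ℕ), ((z : ℂ) + p * ω + q) ^ (-s)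

/-- `S` is the value of the double sine function
`𝒮(ω,z) = exp(G(ω,1+ω-z) - G(ω,z))` where `G(ω,z) = ζ₂'(0,ω,z)`. -/
def IsDoubleSine (ω z : ℝ) (S : ℂ) : Prop :=
  ∃ H1 H2 : ℂ → ℂ, IsBarnesZeta2 ω (1 + ω - z) H1 ∧ IsBarnesZeta2 ω z H2 ∧
    S = Complex.exp (deriv H1 0 - deriv H2 0)



lemma ds_summable_real (a x r : ℝ) (ha : 0 < a) (hx : 0 < x) (hr : 2 < r) :
    Summable fun i : ℕ × ℕ => (x + i.1 * a + i.2) ^ (-r) := by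
  obtain ⟨m, hm, hmx, hma, hm1⟩ : ∃ m : ℝ, 0 < m ∧ m ≤ x ∧ m ≤ a ∧ m ≤ 1 :=
    ⟨min x (min a 1), by positivity, by simp, by simp, by simp⟩
  have h1 : Summable fun n : ℕ => ((n : ℝ) + 1) ^ (-(r / 2)) := by
    have := (Real.summable_nat_rpow (p := -(r/2))).2 (by linarith)
    simpa using (summable_nat_add_iff 1).2 this
  have h2 : Summable fun i : ℕ × ℕ => m ^ (-r) * (((i.1 : ℝ) + 1) ^ (-(r / 2)) * ((i.2 : ℝ) + 1) ^ (-(r / 2))) :=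
    (h1.mul_of_nonneg h1 (fun n => by positivity) (fun n => by positivity)).mul_left _
  refine Summable.of_nonneg_of_le (fun i => by positivity) (fun i => ?_) h2
  obtain ⟨p, q⟩ := i
  simp only
  have hp : (0:ℝ) ≤ p := p.cast_nonneg
  have hq : (0:ℝ) ≤ q := q.cast_nonneg
  have e : m ^ (-r) * (((p : ℝ) + 1) ^ (-(r / 2)) * ((q : ℝ) + 1) ^ (-(r / 2)))
      = (m * Real.sqrt (((p : ℝ) + 1) * (q + 1))) ^ (-r) := by
    rw [Real.mul_rpow hm.le (by positivity), ← Real.mul_rpow (by positivity) (by positivity),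
      Real.sqrt_eq_rpow, ← Real.rpow_mul (by positivity)]
    congr 2; ring
  rw [e]
  apply Real.rpow_le_rpow_of_nonpos (by positivity) _ (by linarith)
  have : Real.sqrt (((p : ℝ) + 1) * (q + 1)) ≤ p + q + 1 := by
    apply Real.sqrt_le_iff.2 ⟨by positivity, by nlinarith⟩
  nlinarith [mul_le_mul_of_nonneg_left this hm.le, mul_nonneg hp (sub_nonneg.2 hma), mul_nonneg hq (sub_nonneg.2 hm1)]

lemma ds_norm (y : ℝ) (hy : 0 < y) (s : ℂ) : ‖((y : ℝ) : ℂ) ^ (-s)‖ = y ^ (-s.re) := by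
  rw [Complex.norm_cpow_eq_rpow_re_of_pos hy, Complex.neg_re]

lemma ds_summable (a x : ℝ) (ha : 0 < a) (hx : 0 < x) (s : ℂ) (hs : 2 < s.re) :
    Summable fun i : ℕ × ℕ => (((x + i.1 * a + i.2 : ℝ)) : ℂ) ^ (-s) := by
  refine Summable.of_norm ?_
  refine (ds_summable_real a x s.re ha hx hs).congr (fun i => ?_)
  rw [ds_norm _ (by positivity)]

lemma ds_split_aux (f : ℕ × ℕ → ℂ) (hf : Summable f) (i j : ℕ × ℕ → ℕ × ℕ)
    (hi : Function.Injective i) (hj : Function.Injective j)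
    (hd : ∀ u v, i u ≠ j v) (hc : ∀ w, (∃ u, i u = w) ∨ (∃ v, j v = w)) :
    ∑' w, f w = ∑' w, f (i w) + ∑' w, f (j w) := by
  have hcompl : IsCompl (Set.range i) (Set.range j) := by
    refine ⟨Set.disjoint_left.2 ?_, codisjoint_iff.2 ?_⟩
    · rintro _ ⟨u, rfl⟩ ⟨v, hv⟩
      exact hd u v hv.symm
    · ext w
      simpa using hc w
  have h1 := (hi.hasSum_range_iff (f := f)).2 (hf.comp_injective hi).hasSum
  have h2 := (hj.hasSum_range_iff (f := f)).2 (hf.comp_injective hj).hasSum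
  exact (h1.add_isCompl hcompl h2).tsum_eq

lemma ds_split1 (f : ℕ × ℕ → ℂ) (hf : Summable f) :
    ∑' w, f w = ∑' w : ℕ × ℕ, f (w.1 + w.2, w.2) + ∑' w : ℕ × ℕ, f (w.1, w.1 + w.2 + 1) := by
  apply ds_split_aux f hf (fun w => (w.1 + w.2, w.2)) (fun w => (w.1, w.1 + w.2 + 1))
  · rintro ⟨a, b⟩ ⟨c, d⟩ h; simp at h ⊢; omega
  · rintro ⟨a, b⟩ ⟨c, d⟩ h; simp at h ⊢; omega
  · rintro ⟨a, b⟩ ⟨c, d⟩ h; simp at h; omega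
  · rintro ⟨a, b⟩
    rcases le_or_gt b a with h | h
    · exact Or.inl ⟨(a - b, b), by simp; omega⟩
    · exact Or.inr ⟨(a, b - a - 1), by simp; omega⟩

lemma ds_split2 (f : ℕ × ℕ → ℂ) (hf : Summable f) :
    ∑' w, f w = ∑' w : ℕ × ℕ, f (w.1 + w.2 + 1, w.2) + ∑' w : ℕ × ℕ, f (w.1, w.1 + w.2) := by
  apply ds_split_aux f hf (fun w => (w.1 + w.2 + 1, w.2)) (fun w => (w.1, w.1 + w.2))
  · rintro ⟨a, b⟩ ⟨c, d⟩ h; simp at h ⊢; omega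
  · rintro ⟨a, b⟩ ⟨c, d⟩ h; simp at h ⊢; omega
  · rintro ⟨a, b⟩ ⟨c, d⟩ h; simp at h; omega
  · rintro ⟨a, b⟩
    rcases lt_or_ge b a with h | h
    · exact Or.inl ⟨(a - b - 1, b), by simp; omega⟩
    · exact Or.inr ⟨(a, b - a), by simp; omega⟩

/-- Barnes double zeta series. -/
noncomputable def dsZ (a x : ℝ) (s : ℂ) : ℂ := ∑' i : ℕ × ℕ, (((x + i.1 * a + i.2 : ℝ)) : ℂ) ^ (-s)

/-- Hurwitz zeta series. -/
noncomputable def dsHz (x : ℝ) (s : ℂ) : ℂ := ∑' n : ℕ, (((x + n : ℝ)) : ℂ) ^ (-s)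

lemma ds_scale (w y : ℝ) (hw : 0 < w) (hy : 0 < y) (s : ℂ) :
    ((w * y : ℝ) : ℂ) ^ (-s) = (w : ℂ) ^ (-s) * (y : ℂ) ^ (-s) := by
  rw [Complex.ofReal_mul, Complex.mul_cpow_ofReal_nonneg hw.le hy.le]

lemma dsZ_split1 (w x : ℝ) (hw : 1 < w) (hx : 0 < x) (s : ℂ) (hs : 2 < s.re) :
    dsZ (w - 1) x s = (w : ℂ) ^ (-s) * dsZ (1 - 1 / w) (x / w) s + dsZ w (x + 1) s := by
  have hw0 : 0 < w := by linarith
  have hal : 0 ≤ 1 - 1 / w := by rw [sub_nonneg, div_le_one hw0]; exact hw.le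
  unfold dsZ
  rw [ds_split1 _ (ds_summable (w - 1) x (by linarith) hx s hs), ← tsum_mul_left]
  congr 1
  · refine tsum_congr (fun i => ?_)
    rw [← ds_scale _ _ hw0 (by positivity)]
    congr 2
    push_cast; field_simp; ring
  · refine tsum_congr (fun i => ?_)
    congr 2
    push_cast; ring

lemma dsZ_split2 (w x : ℝ) (hw : 1 < w) (hx : 0 < x) (s : ℂ) (hs : 2 < s.re) :
    dsZ (w - 1) x s = (w : ℂ) ^ (-s) * dsZ (1 - 1 / w) ((x + w - 1) / w) s + dsZ w x s := by
  have hw0 : 0 < w := by linarith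
  have hal : 0 ≤ 1 - 1 / w := by rw [sub_nonneg, div_le_one hw0]; exact hw.le
  have hxw : 0 < x + w - 1 := by linarith
  unfold dsZ
  rw [ds_split2 _ (ds_summable (w - 1) x (by linarith) hx s hs), ← tsum_mul_left]
  congr 1
  · refine tsum_congr (fun i => ?_)
    rw [← ds_scale _ _ hw0 (by positivity)]
    congr 2
    push_cast; field_simp; ring
  · refine tsum_congr (fun i => ?_)
    congr 2
    push_cast; ring

lemma dsZ_shift (w x : ℝ) (hw : 0 < w) (hx : 0 < x) (s : ℂ) (hs : 2 < s.re) :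
    dsZ w x s = (w : ℂ) ^ (-s) * dsHz (x / w) s + dsZ w (x + 1) s := by
  unfold dsZ dsHz
  have hS := ds_summable w x hw hx s hs
  have hS1 := ds_summable w (x+1) hw (by linarith) s hs
  rw [hS.tsum_prod, hS1.tsum_prod, ← tsum_mul_left]
  have h0 : Summable fun n : ℕ => (w : ℂ) ^ (-s) * ((x / w + n : ℝ) : ℂ) ^ (-s) := by
    refine (hS.comp_injective (i := fun n : ℕ => (n, 0)) (fun a b h => by simpa using h)).congr ?_
    intro n
    rw [← ds_scale _ _ hw (by positivity)]
    simp only [Function.comp]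
    congr 2
    push_cast; field_simp; ring
  rw [← h0.tsum_add hS1.prod]
  refine tsum_congr (fun p => ?_)
  rw [(hS.prod_factor p).tsum_eq_zero_add]
  congr 1
  · rw [← ds_scale _ _ hw (by positivity)]
    congr 2
    push_cast; field_simp; ring
  · refine tsum_congr (fun i => ?_)
    congr 2
    push_cast; ring

lemma dsHz_summable (x : ℝ) (hx : 0 < x) (s : ℂ) (hs : 2 < s.re) :
    Summable fun n : ℕ => ((x + n : ℝ) : ℂ) ^ (-s) := by
  refine ((ds_summable 1 x one_pos hx s hs).comp_injective (i := fun n : ℕ => (0, n)) 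
    (fun a b h => by simpa using h)).congr ?_
  intro n
  simp

lemma ds_rpow_hasDeriv (s : ℂ) (y : ℝ) (hy : 0 < y) :
    HasDerivAt (fun t : ℝ => (t : ℂ) ^ (-s)) (-s * (y : ℂ) ^ (-(s + 1))) y := by
  have h := (hasDerivAt_id (y : ℂ)).cpow_const (c := -s) (Or.inl (by simpa using hy))
  have h2 := h.comp_ofReal
  refine h2.congr_deriv ?_
  simp only [id, mul_one, neg_add']

/-- first difference bound -/
lemma ds_diff_bound (s : ℂ) (N h : ℝ) (hh : 0 ≤ h) (hN : h < N) (hs : -1 < s.re) :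
    ‖((N + h : ℝ) : ℂ) ^ (-s) - ((N - h : ℝ) : ℂ) ^ (-s)‖ ≤
      ‖s‖ * (N - h) ^ (-(s.re + 1)) * (2 * h) := by
  have := Convex.norm_image_sub_le_of_norm_hasDerivWithin_le (𝕜 := ℝ) (f := fun t : ℝ => (t : ℂ) ^ (-s))
    (f' := fun t : ℝ => -s * (t : ℂ) ^ (-(s + 1))) (s := Set.Icc (N - h) (N + h))
    (C := ‖s‖ * (N - h) ^ (-(s.re + 1))) (x := N - h) (y := N + h) ?_ ?_ (convex_Icc _ _) ?_ ?_
  · refine this.trans_eq ?_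
    rw [Real.norm_of_nonneg (by linarith)]; ring
  · intro x hx
    exact (ds_rpow_hasDeriv s x (by linarith [hx.1])).hasDerivWithinAt
  · intro x hx
    have : 0 < N - h := by linarith
    rw [norm_mul, norm_neg, Complex.norm_cpow_eq_rpow_re_of_pos (by linarith [hx.1])]
    gcongr
    simp only [Complex.neg_re, Complex.add_re, Complex.one_re]
    exact Real.rpow_le_rpow_of_nonpos this hx.1 (by linarith)
  · constructor <;> linarith
  · constructor <;> linarith

lemma ds_diff2_bound (s : ℂ) (N u : ℝ) (hu : 0 ≤ u) (hN : u < N) (hs : -1 < s.re) :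
    ‖((N + u : ℝ) : ℂ) ^ (-s) + ((N - u : ℝ) : ℂ) ^ (-s) - 2 * (N : ℂ) ^ (-s)‖ ≤
      ‖s‖ * (‖s + 1‖ * (N - u) ^ (-(s.re + 2)) * (2 * u)) * u := by
  have := Convex.norm_image_sub_le_of_norm_hasDerivWithin_le (𝕜 := ℝ)
    (f := fun t : ℝ => ((N + t : ℝ) : ℂ) ^ (-s) + ((N - t : ℝ) : ℂ) ^ (-s))
    (f' := fun t : ℝ => -s * (((N + t : ℝ) : ℂ) ^ (-(s + 1)) - ((N - t : ℝ) : ℂ) ^ (-(s + 1)))) (s := Set.Icc 0 u)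
    (C := ‖s‖ * (‖s + 1‖ * (N - u) ^ (-(s.re + 2)) * (2 * u))) (x := 0) (y := u) ?_ ?_ (convex_Icc _ _) ?_ ?_
  · refine (Eq.le ?_).trans (this.trans_eq ?_)
    · simp only [add_zero, sub_zero]; congr 1; ring
    · rw [sub_zero, Real.norm_of_nonneg hu]
  · intro x hx
    have h1 := (ds_rpow_hasDeriv s (N + x) (by linarith [hx.1])).scomp x ((hasDerivAt_id x).const_add N)
    have h2 := (ds_rpow_hasDeriv s (N - x) (by linarith [hx.2])).scomp x ((hasDerivAt_id x).const_sub N)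
    refine HasDerivAt.hasDerivWithinAt ?_
    refine (h1.add h2).congr_deriv ?_
    simp; ring
  · intro x hx
    have h0 : 0 < N - u := by linarith
    have h1 : 0 < N - x := by linarith [hx.2]
    rw [norm_mul, norm_neg]
    refine mul_le_mul_of_nonneg_left ?_ (norm_nonneg _)
    refine (ds_diff_bound (s + 1) N x hx.1 (by linarith) (by simp; linarith)).trans ?_
    have e : (-((s + 1).re + 1)) = -(s.re + 2) := by simp; ring
    rw [e]
    have := Real.rpow_le_rpow_of_nonpos h0 (show N - u ≤ N - x by linarith [hx.2]) (show -(s.re + 2) ≤ 0 by linarith)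
    have hx1 := hx.1
    have hx2 := hx.2
    gcongr
  · exact ⟨le_rfl, hu⟩
  · exact ⟨hu, le_rfl⟩

/-- Term of the regularised series. -/
noncomputable def dsT (u : ℝ) (n : ℕ) (s : ℂ) : ℂ :=
  (((n + 1 + u : ℝ)) : ℂ) ^ (-s) + (((n + 1 - u : ℝ)) : ℂ) ^ (-s) - 2 * (((n + 1 : ℝ)) : ℂ) ^ (-s)

/-- Convex domain -/
def dsW : Set ℂ := {s | -(1 / 2) < s.re} ∩ ({s | s.re - 1 / 2 < s.im} ∩ Metric.ball 0 10)

lemma dsW_open : IsOpen dsW := by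
  refine (isOpen_lt continuous_const Complex.continuous_re).inter
    ((isOpen_lt (by fun_prop) Complex.continuous_im).inter Metric.isOpen_ball)

lemma dsW_convex : Convex ℝ dsW := by
  refine (convex_halfSpace_re_gt _).inter (Convex.inter ?_ (convex_ball _ _))
  have : {s : ℂ | s.re - 1 / 2 < s.im} = {s : ℂ | (Complex.reLm - Complex.imLm) s < 1 / 2} := by
    ext s
    simp only [Set.mem_ofPred_eq, LinearMap.sub_apply, Complex.reLm_coe, Complex.imLm_coe]
    constructor <;> intro h <;> linarith
  rw [this]
  exact convex_halfSpace_lt (Complex.reLm - Complex.imLm).isLinear _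

lemma dsW_zero : (0 : ℂ) ∈ dsW := by
  simp [dsW]

lemma ds_ident (f g : ℂ → ℂ) (hf : DifferentiableOn ℂ f dsW) (hg : DifferentiableOn ℂ g dsW)
    (h : ∀ s, 2 < s.re → f s = g s) : Set.EqOn f g dsW := by
  refine (hf.analyticOnNhd dsW_open).eqOn_of_preconnected_of_eventuallyEq
    (hg.analyticOnNhd dsW_open) dsW_convex.isPreconnected (z₀ := 3 + 3 * Complex.I) ?_ ?_
  · refine ⟨by simp; norm_num, by simp, ?_⟩
    rw [mem_ball_zero_iff]
    refine (norm_add_le _ _).trans_lt ?_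
    simp; norm_num
  · filter_upwards [(isOpen_lt continuous_const Complex.continuous_re).mem_nhds
      (show (2:ℝ) < (3 + 3 * Complex.I).re by simp; norm_num)] with s hs
    exact h s hs

lemma dsT_bound (u : ℝ) (hu : 0 < u) (hu1 : u < 1) (n : ℕ) (s : ℂ) (hs : s ∈ dsW) :
    ‖dsT u n s‖ ≤ 220 * (1 - u) ^ (-12 : ℝ) * ((n : ℝ) + 1) ^ (-(3 / 2) : ℝ) := by
  obtain ⟨h1, h2, h3⟩ := hs
  simp only [Set.mem_ofPred_eq] at h1
  rw [mem_ball_zero_iff] at h3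
  have hre : s.re < 10 := (Complex.re_le_norm s).trans_lt h3
  have hn : (0:ℝ) ≤ n := n.cast_nonneg
  have hb := ds_diff2_bound s (n + 1) u hu.le (by linarith) (by linarith)
  refine hb.trans ?_
  have hs1 : ‖s + 1‖ ≤ 11 := (norm_add_le _ _).trans (by simp; linarith)
  have h4 : ((n : ℝ) + 1 - u) ^ (-(s.re + 2)) ≤ (1 - u) ^ (-12 : ℝ) * ((n : ℝ) + 1) ^ (-(3 / 2) : ℝ) := by
    have hu' : 0 < 1 - u := by linarith
    calc ((n : ℝ) + 1 - u) ^ (-(s.re + 2)) ≤ ((1 - u) * (n + 1)) ^ (-(s.re + 2)) := by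
          apply Real.rpow_le_rpow_of_nonpos (by positivity) (by nlinarith) (by linarith)
      _ = (1 - u) ^ (-(s.re + 2)) * ((n : ℝ) + 1) ^ (-(s.re + 2)) :=
          Real.mul_rpow hu'.le (by positivity)
      _ ≤ _ := by
          gcongr ?_ * ?_
          · exact Real.rpow_le_rpow_of_exponent_ge hu' (by linarith) (by linarith)
          · exact Real.rpow_le_rpow_of_exponent_le (by linarith) (by linarith)
  have hX : 0 ≤ (1 - u) ^ (-12 : ℝ) * ((n : ℝ) + 1) ^ (-(3 / 2) : ℝ) := by
    have hu' : 0 < 1 - u := by linarith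
    positivity
  have hY : 0 ≤ ((n : ℝ) + 1 - u) ^ (-(s.re + 2)) := Real.rpow_nonneg (by linarith) _
  set X := (1 - u) ^ (-12 : ℝ) * ((n : ℝ) + 1) ^ (-(3 / 2) : ℝ)
  calc _ ≤ 10 * (11 * X * (2 * 1)) * 1 := by gcongr
    _ = _ := by ring

lemma dsT_diff (u : ℝ) (hu : 0 < u) (hu1 : u < 1) (n : ℕ) : Differentiable ℂ (dsT u n) := by
  have h1 : (0:ℝ) < n + 1 + u := by positivity
  have h2 : (0:ℝ) < n + 1 - u := by have : (0:ℝ) ≤ n := n.cast_nonneg; linarith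
  have h3 : (0:ℝ) < n + 1 := by positivity
  have key (y : ℝ) (hy : 0 < y) : Differentiable ℂ fun s : ℂ => (y : ℂ) ^ (-s) := 
    differentiable_neg.const_cpow (Or.inl (by exact_mod_cast hy.ne'))
  unfold dsT
  exact ((key _ h1).add (key _ h2)).sub ((key _ h3).const_mul 2)

lemma ds_cpow_deriv (y : ℝ) (hy : 0 < y) :
    HasDerivAt (fun s : ℂ => (y : ℂ) ^ (-s)) (-(Real.log y : ℂ)) 0 := by
  have := (hasDerivAt_neg (0:ℂ)).const_cpow (c := (y:ℂ)) (Or.inl (by exact_mod_cast hy.ne'))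
  convert this using 1
  simp [Complex.ofReal_log hy.le]

lemma dsT_deriv (u : ℝ) (hu : 0 < u) (hu1 : u < 1) (n : ℕ) :
    deriv (dsT u n) 0 = ((-Real.log (1 - u ^ 2 / (n + 1) ^ 2) : ℝ) : ℂ) := by
  have h1 : (0:ℝ) < n + 1 + u := by positivity
  have h2 : (0:ℝ) < n + 1 - u := by have : (0:ℝ) ≤ n := n.cast_nonneg; linarith
  have h3 : (0:ℝ) < n + 1 := by positivity
  have := (((ds_cpow_deriv _ h1).add (ds_cpow_deriv _ h2)).sub ((ds_cpow_deriv _ h3).const_mul 2)).deriv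
  refine Eq.trans this ?_
  have e : (1 - u ^ 2 / ((n:ℝ) + 1) ^ 2) = ((n + 1 + u) * (n + 1 - u)) / (n + 1) ^ 2 := by
    field_simp; ring
  rw [e, Real.log_div (by positivity) (by positivity), Real.log_mul h1.ne' h2.ne', Real.log_pow]
  push_cast; ring

lemma dsT_summ : Summable fun n : ℕ => ((n : ℝ) + 1) ^ (-(3 / 2) : ℝ) := by
  have := (Real.summable_nat_rpow (p := -(3/2))).2 (by norm_num)
  simpa using (summable_nat_add_iff 1).2 this

lemma dsT_tsum_diff (u : ℝ) (hu : 0 < u) (hu1 : u < 1) :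
    DifferentiableOn ℂ (fun s => ∑' n, dsT u n s) dsW :=
  Complex.differentiableOn_tsum_of_summable_norm (dsT_summ.mul_left _)
    (fun n => (dsT_diff u hu hu1 n).differentiableOn) dsW_open (fun n s hs => dsT_bound u hu hu1 n s hs)

lemma dsT_tsum_deriv (u : ℝ) (hu : 0 < u) (hu1 : u < 1) :
    deriv (fun s => ∑' n, dsT u n s) 0 = ((-Real.log (Real.sin (Real.pi * u) / (Real.pi * u)) : ℝ) : ℂ) := by
  have h := Complex.hasSum_deriv_of_summable_norm (dsT_summ.mul_left _)
    (fun n => (dsT_diff u hu hu1 n).differentiableOn) dsW_open (fun n s hs => dsT_bound u hu hu1 n s hs) dsW_zero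
  have ht := h.tendsto_sum_nat
  refine tendsto_nhds_unique ht ?_
  have hpi := Real.pi_pos
  have hsin : 0 < Real.sin (Real.pi * u) := Real.sin_pos_of_pos_of_lt_pi (by positivity) (by nlinarith)
  have h2 := (Real.tendsto_euler_sin_prod u).div_const (Real.pi * u)
  have h3 := ((Real.continuousAt_log (by positivity : Real.sin (Real.pi * u) / (Real.pi * u) ≠ 0)).tendsto.comp h2).neg
  have h4 := (Complex.continuous_ofReal.tendsto _).comp h3
  refine h4.congr (fun N => ?_)
  simp only [Function.comp]
  rw [mul_div_cancel_left₀ _ (by positivity), Real.log_prod]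
  · push_cast
    rw [← Finset.sum_neg_distrib]
    refine Finset.sum_congr rfl (fun n _ => ?_)
    rw [dsT_deriv u hu hu1]; push_cast; rfl
  · intro n _
    have h3 : (0:ℝ) ≤ n := n.cast_nonneg
    have : u ^ 2 / ((n:ℝ) + 1) ^ 2 < 1 := by
      rw [div_lt_one (by positivity)]
      nlinarith
    linarith

/-- regularised Hurwitz sum -/
noncomputable def dsB (u : ℝ) (s : ℂ) : ℂ := (u : ℂ) ^ (-s) + ∑' n, dsT u n s + 2 * riemannZeta s

lemma dsB_diff (u : ℝ) (hu : 0 < u) (hu1 : u < 1) : DifferentiableOn ℂ (dsB u) dsW := by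
  refine DifferentiableOn.add (DifferentiableOn.add ?_ (dsT_tsum_diff u hu hu1)) ?_
  · exact (differentiable_neg.const_cpow (Or.inl (by exact_mod_cast hu.ne'))).differentiableOn
  · intro s hs
    refine ((differentiableAt_riemannZeta ?_).const_mul 2).differentiableWithinAt
    rintro rfl
    have := hs.2.1
    simp at this
    linarith

lemma dsB_zero (u : ℝ) : dsB u 0 = 0 := by
  have : ∀ n, dsT u n 0 = 0 := fun n => by simp [dsT]; norm_num
  simp [dsB, this, riemannZeta_zero]; norm_num

lemma dsB_deriv (u : ℝ) (hu : 0 < u) (hu1 : u < 1) :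
    HasDerivAt (dsB u) ((-Real.log (2 * Real.sin (Real.pi * u)) : ℝ) : ℂ) 0 := by
  have hpi := Real.pi_pos
  have hsin : 0 < Real.sin (Real.pi * u) := Real.sin_pos_of_pos_of_lt_pi (by positivity) (by nlinarith)
  have h1 := ds_cpow_deriv u hu
  have h2 := ((dsT_tsum_diff u hu hu1).differentiableAt (dsW_open.mem_nhds dsW_zero)).hasDerivAt
  have h3 := (differentiableAt_riemannZeta (s := 0) (by norm_num)).hasDerivAt.const_mul 2
  rw [dsT_tsum_deriv u hu hu1] at h2
  rw [deriv_riemannZeta_zero] at h3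
  refine ((h1.add h2).add h3).congr_deriv ?_
  have e : Complex.log (2 * (Real.pi : ℂ)) = ((Real.log (2 * Real.pi) : ℝ) : ℂ) := by
    rw [Complex.ofReal_log (by positivity)]; push_cast; rfl
  rw [e, Real.log_div hsin.ne' (by positivity), Real.log_mul (by positivity) (by positivity),
    Real.log_mul (by positivity) (by positivity), Real.log_mul (by positivity) (by positivity)]
  push_cast
  ring

lemma dsHz_eq_dsB (u : ℝ) (hu : 0 < u) (hu1 : u < 1) (s : ℂ) (hs : 2 < s.re) :
    dsHz u s + dsHz (1 - u) s = dsB u s := by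
  have S1 := dsHz_summable u hu s hs
  have S2 := dsHz_summable (1 - u) (by linarith) s hs
  have S3 := dsHz_summable 1 one_pos s hs
  have S1' : Summable fun n : ℕ => ((n + 1 + u : ℝ) : ℂ) ^ (-s) := by
    refine ((summable_nat_add_iff 1).2 S1).congr (fun n => ?_)
    congr 2; push_cast; ring
  have S2' : Summable fun n : ℕ => ((n + 1 - u : ℝ) : ℂ) ^ (-s) := by
    refine S2.congr (fun n => ?_)
    congr 2; push_cast; ring
  have S3' : Summable fun n : ℕ => ((n + 1 : ℝ) : ℂ) ^ (-s) := by
    refine S3.congr (fun n => ?_)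
    congr 2; push_cast; ring
  unfold dsB dsT
  rw [(S1'.add S2').tsum_sub (S3'.mul_left 2), S1'.tsum_add S2', tsum_mul_left,
    zeta_eq_tsum_one_div_nat_add_one_cpow (by linarith)]
  unfold dsHz
  rw [S1.tsum_eq_zero_add]
  have e1 : ∑' n : ℕ, ((u + (n + 1 : ℕ) : ℝ) : ℂ) ^ (-s) = ∑' n : ℕ, ((n + 1 + u : ℝ) : ℂ) ^ (-s) :=
    tsum_congr (fun n => by congr 2; push_cast; ring)
  have e2 : ∑' n : ℕ, ((1 - u + n : ℝ) : ℂ) ^ (-s) = ∑' n : ℕ, ((n + 1 - u : ℝ) : ℂ) ^ (-s) :=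
    tsum_congr (fun n => by congr 2; push_cast; ring)
  have e3 : ∑' n : ℕ, 1 / ((n:ℂ) + 1) ^ s = ∑' n : ℕ, ((n + 1 : ℝ) : ℂ) ^ (-s) :=
    tsum_congr (fun n => by rw [Complex.cpow_neg]; push_cast; simp)
  rw [e1, e2, e3]
  simp
  ring

open Filter Topology Asymptotics in
lemma ds_isBigO_sq (f : ℝ → ℝ) (hf : AnalyticAt ℝ f 0) (h0 : f 0 = 0) (h1 : deriv f 0 = 0) :
    f =O[𝓝 0] fun t => t ^ 2 := by
  obtain ⟨p, hp⟩ := hf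
  have hg : AnalyticAt ℝ (dslope f 0) 0 := ⟨_, hp.has_fpower_series_dslope_fslope⟩
  have hO := hg.differentiableAt.isBigO_sub
  have h2 : (fun t => (t - 0) * (dslope f 0 t - dslope f 0 0)) =O[𝓝 0] fun t : ℝ => (t - 0) * (t - 0) :=
    (isBigO_refl _ _).mul hO
  refine (h2.congr (fun t => ?_) (fun t => ?_))
  · rw [dslope_same, h1, sub_zero]
    have := sub_smul_dslope f 0 t
    simpa [h0] using this
  · ring

/-- `sinh t / t` -/
noncomputable def dsShc : ℝ → ℝ := dslope Real.sinh 0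

lemma dsShc_mul (t : ℝ) : t * dsShc t = Real.sinh t := by
  have := sub_smul_dslope Real.sinh 0 t
  simpa [dsShc] using this

lemma dsShc_zero : dsShc 0 = 1 := by
  simp [dsShc]

lemma dsShc_analytic : AnalyticAt ℝ dsShc 0 := by
  obtain ⟨p, hp⟩ := (Real.analyticAt_sinh (x := 0))
  exact ⟨_, hp.has_fpower_series_dslope_fslope⟩

lemma dsShc_even (t : ℝ) : dsShc (-t) = dsShc t := by
  rcases eq_or_ne t 0 with rfl | h
  · simp
  · have h1 := dsShc_mul t
    have h2 := dsShc_mul (-t)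
    rw [Real.sinh_neg, ← h1] at h2
    have : t * dsShc (-t) = t * dsShc t := by linarith
    exact mul_left_cancel₀ h this

lemma dsShc_deriv : HasDerivAt dsShc 0 0 := by
  have h := dsShc_analytic.differentiableAt.hasDerivAt
  have h2 : HasDerivAt dsShc (deriv dsShc 0 * -1) 0 := by
    have h' : HasDerivAt dsShc (deriv dsShc 0) (-0) := by simpa using h
    have := h'.comp (0:ℝ) (hasDerivAt_neg (0:ℝ))
    refine this.congr_of_eventuallyEq (Filter.Eventually.of_forall fun t => ?_)
    exact (dsShc_even t).symm
  have := h.unique h2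
  have e : deriv dsShc 0 = 0 := by linarith
  rwa [e] at h

/-- remainder -/
noncomputable def dsPsi (d a : ℝ) (t : ℝ) : ℝ :=
  dsShc (d * t) / (dsShc (a * t) * dsShc (1 / 2 * t)) - (1 + t) * Real.exp (-t)

open Filter Topology Asymptotics in
lemma dsPsi_bigO (d a : ℝ) : dsPsi d a =O[𝓝 0] fun t => t ^ 2 := by
  have an (c : ℝ) : AnalyticAt ℝ (fun t => dsShc (c * t)) 0 := by
    refine AnalyticAt.fun_comp (g := dsShc) (f := fun t => c * t) ?_ (by fun_prop)
    simpa using dsShc_analytic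
  have hd (c : ℝ) : HasDerivAt (fun t => dsShc (c * t)) 0 0 := by
    have h' : HasDerivAt dsShc 0 (c * 0) := by simpa using dsShc_deriv
    have := h'.comp (0:ℝ) ((hasDerivAt_id (0:ℝ)).const_mul c)
    refine HasDerivAt.congr_deriv (f := fun t => dsShc (c * t)) this (by simp)
  apply ds_isBigO_sq
  · unfold dsPsi
    refine ((an d).div ((an a).mul (an (1/2))) ?_).sub (by fun_prop)
    simp [dsShc_zero]
  · simp [dsPsi, dsShc_zero]
  · have h1 := (hd d).fun_div ((hd a).fun_mul (hd (1/2))) (by simp [dsShc_zero])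
    have h2 : HasDerivAt (fun t : ℝ => (1 + t) * Real.exp (-t)) 0 0 := by
      have := ((hasDerivAt_id (0:ℝ)).const_add 1).fun_mul (hasDerivAt_neg (0:ℝ)).exp
      simpa using this
    have := (h1.fun_sub h2).deriv
    refine Eq.trans this ?_
    simp

/-- the heat kernel remainder -/
noncomputable def dsR (a x y C : ℝ) (t : ℝ) : ℝ :=
  (Real.exp (-y * t) - Real.exp (-x * t)) * ((1 - Real.exp (-a * t))⁻¹ * (1 - Real.exp (-t))⁻¹)
    - C * (t⁻¹ * Real.exp (-t) + Real.exp (-t))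

lemma ds_one_sub_exp (b t : ℝ) : 1 - Real.exp (-b * t) = 2 * Real.exp (-b * t / 2) * Real.sinh (b / 2 * t) := by
  rw [Real.sinh_eq, ← sub_eq_zero]
  have e1 : Real.exp (-b * t) = Real.exp (-b * t / 2) * Real.exp (-(b / 2 * t)) := by
    rw [← Real.exp_add]; ring_nf
  have e2 : 1 = Real.exp (-b * t / 2) * Real.exp (b / 2 * t) := by
    rw [← Real.exp_add, ← Real.exp_zero]; ring_nf
  rw [e1]; nth_rw 1 [e2]; ring

lemma dsR_eq (a x y : ℝ) (ha : 0 < a) (hxy : x + y = 1 + a) (t : ℝ) (ht : 0 < t) :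
    dsR a x y ((x - y) / a) t = (x - y) / a * (t⁻¹ * dsPsi ((y - x) / 2) (a / 2) t) := by
  have h1 : 1 - Real.exp (-t) = 2 * Real.exp (-t / 2) * Real.sinh (1 / 2 * t) := by
    have := ds_one_sub_exp 1 t
    simpa using this
  have h2 : Real.exp (-y * t) - Real.exp (-x * t) =
      - (2 * (Real.exp (-a * t / 2) * Real.exp (-t / 2)) * Real.sinh ((y - x) / 2 * t)) := by
    have hy : y = (1 + a) / 2 + (y - x) / 2 := by linarith
    have hx : x = (1 + a) / 2 - (y - x) / 2 := by linarith
    rw [Real.sinh_eq]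
    have e1 : Real.exp (-y * t) = Real.exp (-a * t / 2) * Real.exp (-t / 2) * Real.exp (-((y - x) / 2 * t)) := by
      rw [← Real.exp_add, ← Real.exp_add]; congr 1; linear_combination (-t/2) * hxy
    have e2 : Real.exp (-x * t) = Real.exp (-a * t / 2) * Real.exp (-t / 2) * Real.exp (((y - x) / 2 * t)) := by
      rw [← Real.exp_add, ← Real.exp_add]; congr 1; linear_combination (-t/2) * hxy
    rw [e1, e2]; ring
  have hs1 : 0 < Real.sinh (a / 2 * t) := Real.sinh_pos_iff.2 (by positivity)
  have hs2 : 0 < Real.sinh (1 / 2 * t) := Real.sinh_pos_iff.2 (by positivity)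
  unfold dsR dsPsi
  rw [h2, h1, ds_one_sub_exp]
  have k1 := dsShc_mul (a / 2 * t)
  have k2 := dsShc_mul (1 / 2 * t)
  have k3 := dsShc_mul ((y - x) / 2 * t)
  rw [← k1] at hs1 
  rw [← k2] at hs2 
  have p1 : 0 < dsShc (a / 2 * t) := (mul_pos_iff_of_pos_left (by positivity)).1 hs1
  have p2 : 0 < dsShc (1 / 2 * t) := (mul_pos_iff_of_pos_left (by positivity)).1 hs2
  rw [← k1, ← k2, ← k3]
  have q1 := Real.exp_pos (-a * t / 2)
  have q2 := Real.exp_pos (-t / 2)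
  generalize dsShc (a / 2 * t) = A at *
  generalize dsShc (1 / 2 * t) = B at *
  generalize dsShc ((y - x) / 2 * t) = D at *
  generalize Real.exp (-a * t / 2) = E at *
  generalize Real.exp (-t / 2) = G at *
  generalize Real.exp (-t) = K at *
  field_simp
  ring

open Filter Topology Asymptotics in
lemma dsR_zero (a x y : ℝ) (ha : 0 < a) (hxy : x + y = 1 + a) :
    dsR a x y ((x - y) / a) =O[𝓝[>] 0] fun t : ℝ => t ^ (-(-1) : ℝ) := by
  have h := (dsPsi_bigO ((y - x) / 2) (a / 2)).mono (nhdsWithin_le_nhds (s := Set.Ioi 0))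
  have h2 := ((isBigO_refl (fun t : ℝ => t⁻¹) (𝓝[>] 0)).mul h).const_mul_left ((x - y) / a)
  refine h2.congr' ?_ ?_
  · filter_upwards [self_mem_nhdsWithin] with t ht
    exact (dsR_eq a x y ha hxy t ht).symm
  · filter_upwards [self_mem_nhdsWithin] with t ht
    have : t ≠ 0 := ne_of_gt ht
    simp; field_simp

open Filter Topology Asymptotics in
lemma dsR_top (a x y C m : ℝ) (ha : 0 < a) (hx : m ≤ x) (hy : m ≤ y) (hm : m ≤ 1) :
    dsR a x y C =O[atTop] fun t : ℝ => Real.exp (-m * t) := by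
  have hexp (b : ℝ) (hb : m ≤ b) : (fun t : ℝ => Real.exp (-b * t)) =O[atTop] fun t : ℝ => Real.exp (-m * t) := by
    refine IsBigO.of_bound 1 ?_
    filter_upwards [eventually_ge_atTop 0] with t ht
    rw [Real.norm_of_nonneg (Real.exp_pos _).le, Real.norm_of_nonneg (Real.exp_pos _).le, one_mul]
    apply Real.exp_le_exp.2
    nlinarith
  have h1 (b : ℝ) (hb : 0 < b) : (fun t : ℝ => (1 - Real.exp (-b * t))⁻¹) =O[atTop] fun _ : ℝ => (1:ℝ) := by
    have : Tendsto (fun t : ℝ => (1 - Real.exp (-b * t))⁻¹) atTop (𝓝 (1 - 0)⁻¹) := by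
      refine Tendsto.inv₀ (tendsto_const_nhds.sub ?_) (by norm_num)
      refine Real.tendsto_exp_atBot.comp ?_
      exact tendsto_id.const_mul_atTop_of_neg (by linarith)
    exact this.isBigO_one ℝ
  have h2 : (fun t : ℝ => t⁻¹) =O[atTop] fun _ : ℝ => (1:ℝ) := tendsto_inv_atTop_zero.isBigO_one ℝ
  have e1 := hexp 1 hm
  have e2 := h1 1 one_pos
  simp only [neg_mul, one_mul] at e1 e2
  have f1 := ((hexp y hy).sub (hexp x hx)).mul ((h1 a ha).mul e2)
  have e3 : (fun t : ℝ => Real.exp (-t)) =O[atTop] fun t : ℝ => 1 * Real.exp (-(m * t)) := by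
    simp only [one_mul]; exact e1
  have f2 := ((h2.mul e1).add e3).const_mul_left C
  simp only [mul_one, one_mul, neg_mul] at f1 f2
  have := f1.sub f2
  simp only [← neg_mul] at this
  refine this.congr (fun t => ?_) (fun t => rfl)
  simp [dsR]

lemma dsR_cont (a x y C : ℝ) (ha : 0 < a) : ContinuousOn (dsR a x y C) (Set.Ioi 0) := by
  intro t ht
  have ht : 0 < t := ht
  refine ContinuousAt.continuousWithinAt ?_
  have h1 : 1 - Real.exp (-a * t) ≠ 0 := by
    have : Real.exp (-a * t) < 1 := Real.exp_lt_one_iff.2 (by nlinarith)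
    linarith
  have h2 : 1 - Real.exp (-t) ≠ 0 := by
    have : Real.exp (-t) < 1 := Real.exp_lt_one_iff.2 (by linarith)
    linarith
  have h3 := ht.ne'
  unfold dsR
  fun_prop (disch := assumption)

open MeasureTheory in
lemma dsR_mellin (a x y : ℝ) (ha : 0 < a) (hx : 0 < x) (hy : 0 < y) (hxy : x + y = 1 + a) (s : ℂ)
    (hs : -1 < s.re) :
    MellinConvergent (fun t => ((dsR a x y ((x - y) / a) t : ℝ) : ℂ)) s ∧
    DifferentiableAt ℂ (mellin (fun t => ((dsR a x y ((x - y) / a) t : ℝ) : ℂ))) s := by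
  have hm : 0 < min x (min y 1) := by positivity
  have h1 : LocallyIntegrableOn (fun t => ((dsR a x y ((x - y) / a) t : ℝ) : ℂ)) (Set.Ioi 0) :=
    (Complex.continuous_ofReal.comp_continuousOn (dsR_cont a x y _ ha)).locallyIntegrableOn measurableSet_Ioi
  have h2 := Complex.isBigO_ofReal_left.2 (dsR_top a x y ((x - y) / a) _ ha (by simp : min x (min y 1) ≤ x) (by simp) (by simp))
  have h3 := Complex.isBigO_ofReal_left.2 (dsR_zero a x y ha hxy)
  exact ⟨mellinConvergent_of_isBigO_rpow_exp hm h1 h2 h3 hs,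
    mellin_differentiableAt_of_isBigO_rpow_exp hm h1 h2 h3 hs⟩

lemma ds_hasSum_exp (a x : ℝ) (ha : 0 < a) (t : ℝ) (ht : 0 < t) :
    HasSum (fun i : ℕ × ℕ => Real.exp (-(x + i.1 * a + i.2) * t))
      (Real.exp (-x * t) * ((1 - Real.exp (-a * t))⁻¹ * (1 - Real.exp (-t))⁻¹)) := by
  have g1 := hasSum_geometric_of_lt_one (Real.exp_pos (-a * t)).le (Real.exp_lt_one_iff.2 (by nlinarith))
  have g2 := hasSum_geometric_of_lt_one (Real.exp_pos (-t)).le (Real.exp_lt_one_iff.2 (by nlinarith))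
  have := (g1.mul g2 (g1.summable.mul_of_nonneg g2.summable (fun n => by simp only [Pi.zero_apply]; positivity)
    (fun n => by simp only [Pi.zero_apply]; positivity))).mul_left (Real.exp (-x * t))
  have e : (fun i : ℕ × ℕ => Real.exp (-(x + i.1 * a + i.2) * t)) =
      fun i : ℕ × ℕ => Real.exp (-x * t) * (Real.exp (-a * t) ^ i.1 * Real.exp (-t) ^ i.2) := by
    funext i
    rw [← Real.exp_nat_mul, ← Real.exp_nat_mul, ← Real.exp_add, ← Real.exp_add]
    congr 1; ring
  rw [e]
  exact this

lemma ds_hasSum_sum {E : Type*} [NormedAddCommGroup E] (f : (ℕ × ℕ) ⊕ (ℕ × ℕ) → E) (g1 g2 : ℕ × ℕ → E)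
    (A B : E) (h1 : HasSum g1 A) (h2 : HasSum g2 B) (e1 : ∀ i, f (Sum.inl i) = g1 i)
    (e2 : ∀ i, f (Sum.inr i) = g2 i) : HasSum f (A + B) := by
  obtain rfl : g1 = fun i => f (Sum.inl i) := funext fun i => (e1 i).symm
  obtain rfl : g2 = fun i => f (Sum.inr i) := funext fun i => (e2 i).symm
  have h1 := (Sum.inl_injective.hasSum_range_iff (f := f)).2 h1
  have h2 := (Sum.inr_injective.hasSum_range_iff (f := f)).2 h2
  exact h1.add_isCompl Set.isCompl_range_inl_range_inr h2

lemma ds_exp_mellin (s : ℂ) (hs : 0 < s.re) :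
    HasMellin (fun t : ℝ => ((Real.exp (-t) : ℝ) : ℂ)) s (Complex.Gamma s) := by
  constructor
  · have := Complex.GammaIntegral_convergent hs
    refine this.congr_fun (fun t ht => ?_) measurableSet_Ioi
    simp [mul_comm]
  · rw [← Complex.GammaIntegral_eq_mellin, Complex.Gamma_eq_integral hs]

/-- full heat kernel -/
noncomputable def dsF (a x y C : ℝ) (t : ℝ) : ℂ :=
  ((dsR a x y C t : ℝ) : ℂ) + ((C : ℂ) • ((t : ℂ) ^ (-1 : ℂ) • ((Real.exp (-t) : ℝ) : ℂ))
    + (C : ℂ) • ((Real.exp (-t) : ℝ) : ℂ))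

lemma dsF_eq (a x y C t : ℝ) : dsF a x y C t =
    (((Real.exp (-y * t) - Real.exp (-x * t)) *
      ((1 - Real.exp (-a * t))⁻¹ * (1 - Real.exp (-t))⁻¹) : ℝ) : ℂ) := by
  unfold dsF dsR
  rw [Complex.cpow_neg_one]
  simp only [smul_eq_mul]
  push_cast
  ring

lemma dsF_mellin (a x y : ℝ) (ha : 0 < a) (hx : 0 < x) (hy : 0 < y) (hxy : x + y = 1 + a) (s : ℂ)
    (hs : 2 < s.re) : mellin (dsF a x y ((x - y) / a)) s =
      mellin (fun t => ((dsR a x y ((x - y) / a) t : ℝ) : ℂ)) s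
      + (((x - y) / a : ℝ) * Complex.Gamma (s - 1) + ((x - y) / a : ℝ) * Complex.Gamma s) := by
  have h1 := (dsR_mellin a x y ha hx hy hxy s (by linarith)).1
  have h2 := ds_exp_mellin s (by linarith)
  have h3 := ds_exp_mellin (s + -1) (by simp; linarith)
  have c3 := (MellinConvergent.cpow_smul (f := fun t : ℝ => ((Real.exp (-t) : ℝ) : ℂ)) (s := s) (a := -1)).2 h3.1
  set C := (x - y) / a
  have k2 := h2.1.const_smul (C : ℂ)
  have k3 := c3.const_smul (C : ℂ)
  have := (hasMellin_add h1 (hasMellin_add k3 k2).1).2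
  unfold dsF
  rw [this, (hasMellin_add k3 k2).2, mellin_const_smul, mellin_const_smul, mellin_cpow_smul, h3.2, h2.2]
  simp [sub_eq_add_neg]

lemma ds_gamma_mul (a x y : ℝ) (ha : 0 < a) (hx : 0 < x) (hy : 0 < y) (C : ℝ) (s : ℂ)
    (hs : 2 < s.re) : Complex.Gamma s * (dsZ a y s - dsZ a x s) = mellin (dsF a x y C) s := by
  have key := hasSum_mellin (ι := (ℕ × ℕ) ⊕ (ℕ × ℕ)) (a := Sum.elim (fun _ => 1) (fun _ => -1))
    (p := Sum.elim (fun i => y + i.1 * a + i.2) (fun i => x + i.1 * a + i.2))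
    (F := dsF a x y C) (s := s) ?_ (by linarith) ?_ ?_
  · have S1 := (ds_summable a y ha hy s hs).hasSum.mul_left (Complex.Gamma s)
    have S2 := (ds_summable a x ha hx s hs).hasSum.mul_left (-Complex.Gamma s)
    have := ds_hasSum_sum (fun i => Complex.Gamma s * (Sum.elim (fun _ => 1) (fun _ => -1) i : ℂ) /
      (((Sum.elim (fun i => y + i.1 * a + i.2) (fun i => x + i.1 * a + i.2) i : ℝ)) : ℂ) ^ s) _ _ _ _ S1 S2 ?_ ?_
    · rw [← this.unique key]; unfold dsZ; ring
    · intro i; simp [Complex.cpow_neg, div_eq_mul_inv]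
    · intro i; simp [Complex.cpow_neg, div_eq_mul_inv]
  · rintro (i | i)
    · right; simp only [Sum.elim_inl]; positivity
    · right; simp only [Sum.elim_inr]; positivity
  · intro t ht
    have E1 := Complex.hasSum_ofReal.2 (ds_hasSum_exp a y ha t ht)
    have E2 := (Complex.hasSum_ofReal.2 (ds_hasSum_exp a x ha t ht)).neg
    rw [dsF_eq]
    have := ds_hasSum_sum (fun i => (Sum.elim (fun _ => 1) (fun _ => -1) i : ℂ) *
      ((Real.exp (-(Sum.elim (fun i => y + i.1 * a + i.2) (fun i => x + i.1 * a + i.2) i : ℝ) * t) : ℝ) : ℂ)) _ _ _ _ E1 E2 ?_ ?_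
    · rw [show (((Real.exp (-y * t) - Real.exp (-x * t)) *
        ((1 - Real.exp (-a * t))⁻¹ * (1 - Real.exp (-t))⁻¹) : ℝ) : ℂ) =
        ((Real.exp (-y * t) * ((1 - Real.exp (-a * t))⁻¹ * (1 - Real.exp (-t))⁻¹) : ℝ) : ℂ) +
        -((Real.exp (-x * t) * ((1 - Real.exp (-a * t))⁻¹ * (1 - Real.exp (-t))⁻¹) : ℝ) : ℂ)
        by push_cast; ring]
      exact this
    · intro i; simp
    · intro i; simp
  · have S1 := (ds_summable_real a y s.re ha hy hs).hasSum
    have S2 := (ds_summable_real a x s.re ha hx hs).hasSum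
    refine (ds_hasSum_sum _ _ _ _ _ S1 S2 ?_ ?_).summable
    · intro i
      simp only [Sum.elim_inl, norm_one]
      rw [Real.rpow_neg (by positivity), one_div]
    · intro i
      simp only [Sum.elim_inr, norm_neg, norm_one]
      rw [Real.rpow_neg (by positivity), one_div]

lemma ds_value_zero (a x y : ℝ) (ha : 0 < a) (hx : 0 < x) (hy : 0 < y) (hxy : x + y = 1 + a)
    (H1 H2 : ℂ → ℂ) (d1 : DifferentiableOn ℂ H1 dsW) (d2 : DifferentiableOn ℂ H2 dsW)
    (h1 : ∀ s : ℂ, 2 < s.re → H1 s = dsZ a y s) (h2 : ∀ s : ℂ, 2 < s.re → H2 s = dsZ a x s) :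
    H1 0 - H2 0 = 0 := by
  set C := (x - y) / a with hC
  have := ds_ident (fun s => H1 s - H2 s)
    (fun s => (Complex.Gamma s)⁻¹ * mellin (fun t => ((dsR a x y C t : ℝ) : ℂ)) s + C * (s - 1)⁻¹ + C)
    (d1.sub d2) ?_ ?_ dsW_zero
  · simp only at this
    rw [this]; simp
  · intro s hs
    refine DifferentiableAt.differentiableWithinAt ?_
    have hs1 : s - 1 ≠ 0 := by
      intro h
      obtain rfl : s = 1 := by linear_combination h
      have := hs.2.1
      simp at this
      linarith
    have hm := (dsR_mellin a x y ha hx hy hxy s (by have := hs.1; simp at this; linarith)).2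
    have hg := Complex.differentiable_one_div_Gamma s
    have hi : DifferentiableAt ℂ (fun s : ℂ => (C : ℂ) * (s - 1)⁻¹) s :=
      ((differentiableAt_id.sub_const (1:ℂ)).fun_inv hs1).const_mul _
    exact ((hg.fun_mul hm).fun_add hi).add_const _
  · intro s hs
    rw [h1 s hs, h2 s hs]
    have k1 := ds_gamma_mul a x y ha hx hy C s hs
    rw [dsF_mellin a x y ha hx hy hxy s hs] at k1
    have hs1 : s - 1 ≠ 0 := by
      intro h
      obtain rfl : s = 1 := by linear_combination h
      norm_num at hs
    have hg := Complex.Gamma_add_one (s - 1) hs1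
    rw [sub_add_cancel] at hg
    have hg0 : Complex.Gamma (s - 1) ≠ 0 := Complex.Gamma_ne_zero_of_re_pos (by simp; linarith)
    rw [hg] at k1 ⊢
    rw [← hC] at k1
    field_simp
    linear_combination k1

lemma ds_barnes (ω x : ℝ) (hω : 0 < ω) (hx : 0 < x) (H : ℂ → ℂ) (h : IsBarnesZeta2 ω x H) :
    DifferentiableOn ℂ H dsW ∧ ∀ s : ℂ, 2 < s.re → H s = dsZ ω x s := by
  constructor
  · refine h.1.mono (fun s hs => ?_)
    have h2 := hs.2.1
    simp only [Set.mem_ofPred_eq] at h2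
    simp only [Set.mem_compl_iff, Set.mem_insert_iff, Set.mem_singleton_iff, not_or]
    constructor <;> rintro rfl <;> norm_num at h2
  · intro s hs
    rw [h.2 s hs]
    unfold dsZ
    rw [(ds_summable ω x hω hx s hs).tsum_prod]
    push_cast
    rfl

open Real in
/-- Descent relation: for `ω > 1` and `0 < z < 1`,
`𝒮(ω,z) = 2 sin(πz/ω) · 𝒮(ω-1, z) / 𝒮(1 - 1/ω, z/ω)`. -/
theorem doubleSine_descent (ω z : ℝ) (hω : 1 < ω) (hz : 0 < z) (hz' : z < 1)
    (S1 S2 S3 : ℂ) (h1 : IsDoubleSine ω z S1) (h2 : IsDoubleSine (ω - 1) z S2)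
    (h3 : IsDoubleSine (1 - 1 / ω) (z / ω) S3) :
    S1 = ((2 * Real.sin (π * z / ω) : ℝ) : ℂ) * S2 / S3 := by
  obtain ⟨A1, A2, hA1, hA2, rfl⟩ := h1
  obtain ⟨B1, B2, hB1, hB2, rfl⟩ := h2
  obtain ⟨C1, C2, hC1, hC2, rfl⟩ := h3
  have hω0 : 0 < ω := by linarith
  have hu : 0 < z / ω := by positivity
  have hu1 : z / ω < 1 := by rw [div_lt_one hω0]; linarith
  have hal : 0 < 1 - 1 / ω := by rw [sub_pos, div_lt_one hω0]; exact hω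
  have hy : 0 < 1 + (1 - 1 / ω) - z / ω := by linarith
  obtain ⟨dA1, eA1⟩ := ds_barnes _ _ hω0 (by linarith) _ hA1
  obtain ⟨dA2, eA2⟩ := ds_barnes _ _ hω0 hz _ hA2
  obtain ⟨dB1, eB1⟩ := ds_barnes _ _ (by linarith) (by linarith) _ hB1
  obtain ⟨dB2, eB2⟩ := ds_barnes _ _ (by linarith) hz _ hB2
  obtain ⟨dC1, eC1⟩ := ds_barnes _ _ hal hy _ hC1
  obtain ⟨dC2, eC2⟩ := ds_barnes _ _ hal hu _ hC2
  have hC0 := ds_value_zero _ _ _ hal hu hy (by ring) C1 C2 dC1 dC2 eC1 eC2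
  have dP : Differentiable ℂ fun s : ℂ => (ω : ℂ) ^ (-s) :=
    differentiable_neg.const_cpow (Or.inl (by exact_mod_cast hω0.ne'))
  have key := ds_ident (fun s => B1 s - B2 s)
    (fun s => (ω : ℂ) ^ (-s) * (C1 s - C2 s) + (A1 s - A2 s) + (ω : ℂ) ^ (-s) * dsB (z / ω) s)
    (dB1.fun_sub dB2) (((dP.differentiableOn.fun_mul (dC1.fun_sub dC2)).fun_add (dA1.fun_sub dA2)).fun_add
      (dP.differentiableOn.fun_mul (dsB_diff _ hu hu1))) ?_
  · have nh := dsW_open.mem_nhds dsW_zero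
    have dd {f : ℂ → ℂ} (hf : DifferentiableOn ℂ f dsW) : HasDerivAt f (deriv f 0) 0 :=
      (hf.differentiableAt nh).hasDerivAt
    have hP := ds_cpow_deriv ω hω0
    have D1 := (dd dB1).fun_sub (dd dB2)
    have D2 := ((hP.fun_mul ((dd dC1).fun_sub (dd dC2))).fun_add ((dd dA1).fun_sub (dd dA2))).fun_add
      (hP.fun_mul (dsB_deriv _ hu hu1))
    have e := (D1.congr_of_eventuallyEq (Filter.eventuallyEq_of_mem nh key).symm).unique D2
    rw [hC0, dsB_zero] at e
    have hsin : 0 < 2 * Real.sin (π * (z / ω)) := by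
      have := Real.sin_pos_of_pos_of_lt_pi (x := π * (z / ω)) (by positivity) (by nlinarith [Real.pi_pos])
      positivity
    rw [mul_div_assoc π z ω]
    simp only [mul_zero, zero_add, neg_zero, Complex.cpow_zero, one_mul] at e
    have hh : ((2 * Real.sin (π * (z / ω)) : ℝ) : ℂ) =
        Complex.exp ((Real.log (2 * Real.sin (π * (z / ω))) : ℝ) : ℂ) := by
      rw [← Complex.ofReal_exp, Real.exp_log hsin]
    rw [e, eq_div_iff (Complex.exp_ne_zero _), hh, ← Complex.exp_add, ← Complex.exp_add]
    congr 1
    push_cast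
    ring
  · intro s hs
    rw [eB1 s hs, eB2 s hs, eC1 s hs, eC2 s hs, eA1 s hs, eA2 s hs]
    have a1 := dsZ_split1 ω z hω hz s hs
    have a2 := dsZ_split2 ω (ω - z) hω (by linarith) s hs
    have a3 := dsZ_shift ω z hω0 hz s hs
    have a4 := dsZ_shift ω (ω - z) hω0 (by linarith) s hs
    have a5 := dsHz_eq_dsB _ hu hu1 s hs
    have r1 : (ω - z + ω - 1) / ω = 1 + (1 - 1 / ω) - z / ω := by field_simp; ring
    have r2 : (ω - z) / ω = 1 - z / ω := by field_simp
    have r3 : 1 + (ω - 1) - z = ω - z := by ring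
    have r4 : ω - z + 1 = 1 + ω - z := by ring
    rw [r1] at a2
    rw [r2, r4] at a4
    rw [r3, a1, a2, ← a5]
    linear_combination a3 + a4
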